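/- Let T be a caterpillar on at least 2 vertices. Then P_b(T) = diam(T), the diameter of T. -/

import Mathlib

variable {V : Type*}

/-- The eccentricity of a vertex: the maximum distance to any vertex. -/
noncomputable def ecc (G : SimpleGraph V) [Fintype V] (v : V) : ℕ :=
  Finset.univ.sup (fun u => G.dist u v)

/-- A broadcast on `G`: a function assigning each vertex a power at most its eccentricity. -/
def IsBroadcast (G : SimpleGraph V) [Fintype V] (f : V → ℕ) : Prop :=
  ∀ v, f v ≤ ecc G v

/-- `u` hears the broadcasting vertex `v`. -/
def Hears (G : SimpleGraph V) (f : V → ℕ) (u v : V) : Prop :=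
  0 < f v ∧ G.dist u v ≤ f v

/-- An independent broadcast: no broadcasting vertex hears another vertex. -/
def IsIndepBroadcast (G : SimpleGraph V) [Fintype V] (f : V → ℕ) : Prop :=
  IsBroadcast G f ∧ ∀ v w, 0 < f v → v ≠ w → ¬ Hears G f v w

/-- The broadcast independence number: the maximum weight of an independent broadcast. -/
noncomputable def alphaB (G : SimpleGraph V) [Fintype V] : ℕ :=
  sSup {w | ∃ f, IsIndepBroadcast G f ∧ w = ∑ v, f v}

/-- A packing broadcast: every vertex hears at most one broadcasting vertex. -/
def IsPackingBroadcast (G : SimpleGraph V) [Fintype V] (f : V → ℕ) : Prop :=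
  IsBroadcast G f ∧ ∀ u : V, {v | Hears G f u v}.Subsingleton

/-- The broadcast packing number: the maximum weight of a packing broadcast. -/
noncomputable def Pb (G : SimpleGraph V) [Fintype V] : ℕ :=
  sSup {w | ∃ f, IsPackingBroadcast G f ∧ w = ∑ v, f v}

/-- A multicover: a set of vertices such that every ball of radius `r` (with
`1 ≤ r ≤ ecc v`) contains at least `r` of its elements. -/
def IsMulticover (G : SimpleGraph V) [Fintype V] (S : Finset V) : Prop :=
  ∀ v : V, ∀ r : ℕ, 1 ≤ r → r ≤ ecc G v → r ≤ (S.filter (fun u => G.dist u v ≤ r)).card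

/-- The multicover number: the minimum cardinality of a multicover. -/
noncomputable def Mc (G : SimpleGraph V) [Fintype V] : ℕ :=
  sInf {n | ∃ S : Finset V, IsMulticover G S ∧ n = S.card}

/-- The diameter of `G`: the maximum eccentricity. -/
noncomputable def graphDiam (G : SimpleGraph V) [Fintype V] : ℕ :=
  Finset.univ.sup (ecc G)

/-- A caterpillar: a tree in which every vertex is within distance `1` of a central path. -/
def IsCaterpillar (G : SimpleGraph V) [Fintype V] : Prop :=
  G.IsTree ∧ ∃ (x y : V) (p : G.Walk x y), p.IsPath ∧
    ∀ v : V, ∃ u ∈ p.support, G.dist v u ≤ 1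

theorem aux_core {V : Type*} [Fintype V] (G : SimpleGraph V) (hc : G.Connected)
    (L : ℕ) (u : ℕ → V)
    (hu : ∀ i j, i ≤ j → j ≤ L → G.dist (u i) (u j) ≤ j - i)
    (hv : ∀ v, (∃ i ≤ L, v = u i) ∨ ∃ i, 1 ≤ i ∧ i + 1 ≤ L ∧ G.dist v (u i) ≤ 1)
    (f : V → ℕ) (hf : IsPackingBroadcast G f) : ∑ v, f v ≤ L := by
  classical
  have hu' : ∀ i j, i ≤ L → j ≤ L → G.dist (u i) (u j) ≤ (j - i) + (i - j) := by
    intro i j hi hj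
    rcases le_total i j with h | h
    · have := hu i j h hj; omega
    · have := hu j i h hi; rw [G.dist_comm] at this; omega
  have hecc : ∀ v, ecc G v ≤ L := by
    intro v
    refine Finset.sup_le fun w _ => ?_
    rcases hv v with ⟨i, hi, rfl⟩ | ⟨i, hi, hi', hd⟩ <;>
      rcases hv w with ⟨j, hj, rfl⟩ | ⟨j, hj, hj', hd'⟩
    · have := hu' j i hj hi; omega
    · have := hu' j i (by omega) hi
      have := hc.dist_triangle (u := w) (v := u j) (w := u i); omega
    · have := hu' j i (by omega) (by omega)
      rw [G.dist_comm] at hd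
      have := hc.dist_triangle (u := u j) (v := u i) (w := v); omega
    · have := hu' j i (by omega) (by omega)
      rw [G.dist_comm] at hd
      have := hc.dist_triangle (u := u j) (v := u i) (w := v)
      have := hc.dist_triangle (u := w) (v := u j) (w := v); omega
  let B : V → Finset ℕ := fun v => (Finset.Icc 1 L).filter (fun i => 0 < f v ∧ G.dist (u i) v ≤ f v)
  have hB : ∀ v, f v ≤ (B v).card := by
    intro v
    rcases Nat.eq_zero_or_pos (f v) with h0 | h0
    · omega
    have hle : f v ≤ L := (hf.1 v).trans (hecc v)
    rcases hv v with ⟨i, hi, rfl⟩ | ⟨i, hi, hi', hd⟩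
    · have hs : Finset.Icc (max 1 (i - f (u i))) (min L (i + f (u i))) ⊆ B (u i) := by
        intro j hj
        simp only [Finset.mem_Icc, B, Finset.mem_filter] at hj ⊢
        have := hu' j i (by omega) hi
        refine ⟨by omega, h0, by omega⟩
      refine le_trans ?_ (Finset.card_le_card hs)
      rw [Nat.card_Icc]; omega
    · have hs : Finset.Icc (max 1 (i - (f v - 1))) (min L (i + (f v - 1))) ⊆ B v := by
        intro j hj
        simp only [Finset.mem_Icc, B, Finset.mem_filter] at hj ⊢
        have := hu' j i (by omega) (by omega)
        rw [G.dist_comm] at hd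
        have := hc.dist_triangle (u := u j) (v := u i) (w := v)
        refine ⟨by omega, h0, by omega⟩
      refine le_trans ?_ (Finset.card_le_card hs)
      rw [Nat.card_Icc]; omega
  calc ∑ v, f v ≤ ∑ v, (B v).card := Finset.sum_le_sum fun v _ => hB v
    _ = (Finset.univ.biUnion B).card := by
      rw [Finset.card_biUnion]
      intro v _ w _ hvw
      rw [Function.onFun, Finset.disjoint_left]
      intro i hi hi'
      simp only [B, Finset.mem_filter] at hi hi'
      exact hvw (hf.2 (u i) hi.2 hi'.2)
    _ ≤ (Finset.Icc 1 L).card := by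
      apply Finset.card_le_card
      intro i hi
      simp only [B, Finset.mem_biUnion, Finset.mem_filter] at hi
      obtain ⟨v, _, hi, _⟩ := hi
      exact hi
    _ = L := by simp

theorem aux_path {V : Type*} [Fintype V] (G : SimpleGraph V)
    (hG : IsCaterpillar G) : ∃ (x y : V) (p : G.Walk x y), p.IsPath ∧
    ∀ v, (∃ i ≤ p.length, v = p.getVert i) ∨
      ∃ i, 1 ≤ i ∧ i + 1 ≤ p.length ∧ G.dist v (p.getVert i) ≤ 1 := by
  classical
  obtain ⟨hT, hp⟩ := hG
  let P : ℕ → Prop := fun n => ∃ (x y : V) (p : G.Walk x y), p.IsPath ∧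
    (∀ v : V, ∃ u ∈ p.support, G.dist v u ≤ 1) ∧ p.length = n
  obtain ⟨x0, y0, p0, h0, h0'⟩ := hp
  have hP0 : P p0.length := ⟨x0, y0, p0, h0, h0', rfl⟩
  have hbd : ∀ n, P n → n ≤ Fintype.card V := by
    rintro n ⟨x, y, p, hp, -, rfl⟩
    exact hp.length_lt.le
  have hmax := Nat.findGreatest_spec (hbd _ hP0) hP0
  have hgr : ∀ n, P n → n ≤ Nat.findGreatest P (Fintype.card V) :=
    fun n hn => Nat.le_findGreatest (hbd n hn) hn
  obtain ⟨x, y, p, hp, hd, hl⟩ := hmax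
  rw [← hl] at hgr
  have key : ∀ (a b : V) (q : G.Walk a b), q.IsPath → q.length = p.length →
      q.support.toFinset = p.support.toFinset → ∀ v, v ∉ p.support → ¬ G.Adj v a := by
    intro a b q hq hql hqs v hv hadj
    have hmem : ∀ w, w ∈ q.support ↔ w ∈ p.support := by
      intro w
      rw [← List.mem_toFinset, hqs, List.mem_toFinset]
    have := hgr (q.length + 1) ⟨v, b, SimpleGraph.Walk.cons hadj q, ?_, ?_, by simp⟩
    · omega
    · rw [SimpleGraph.Walk.cons_isPath_iff]
      exact ⟨hq, fun h => hv ((hmem v).1 h)⟩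
    · intro w
      obtain ⟨z, hz, hz'⟩ := hd w
      exact ⟨z, by simp [(hmem z).2 hz], hz'⟩
  refine ⟨x, y, p, hp, fun v => ?_⟩
  by_cases hvp : v ∈ p.support
  · obtain ⟨i, hi, hi'⟩ := SimpleGraph.Walk.mem_support_iff_exists_getVert.1 hvp
    exact Or.inl ⟨i, hi', hi.symm⟩
  · right
    obtain ⟨z, hz, hz'⟩ := hd v
    have hne : v ≠ z := fun h => hvp (h ▸ hz)
    have hpos := hT.1.pos_dist_of_ne hne
    have hadj : G.Adj v z := SimpleGraph.dist_eq_one_iff_adj.1 (by omega)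
    obtain ⟨i, hi, hi'⟩ := SimpleGraph.Walk.mem_support_iff_exists_getVert.1 hz
    refine ⟨i, ?_, ?_, by rw [hi]; exact hz'⟩
    · by_contra h
      have h : i = 0 := by omega
      subst h
      rw [SimpleGraph.Walk.getVert_zero] at hi
      subst hi
      exact key _ _ p hp rfl rfl v hvp hadj
    · by_contra h
      have h : i = p.length := by omega
      subst h
      rw [SimpleGraph.Walk.getVert_length] at hi
      subst hi
      exact key _ _ p.reverse hp.reverse (by simp) (by simp) v hvp hadj

theorem aux_dist {V : Type*} (G : SimpleGraph V) (x y : V) (p : G.Walk x y) (i j : ℕ)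
    (hij : i ≤ j) : G.dist (p.getVert i) (p.getVert j) ≤ j - i := by
  have h := SimpleGraph.dist_le ((p.drop i).take (j - i))
  have e : (p.drop i).getVert (j - i) = p.getVert j := by
    rw [SimpleGraph.Walk.drop_getVert]; congr 1; omega
  rw [← e]
  refine h.trans ?_
  simp [SimpleGraph.Walk.take_length]

/-- the broadcast packing number of a caterpillar on at least two vertices
equals its diameter. -/
theorem stmt18 {V : Type*} [Fintype V] [Nontrivial V] (G : SimpleGraph V)
    (hG : IsCaterpillar G) :
    Pb G = graphDiam G := by
  classical
  have hT := hG.1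
  obtain ⟨x, y, p, hp, hd⟩ := aux_path G hG
  have hup : ∀ f, IsPackingBroadcast G f → ∑ v, f v ≤ p.length := fun f hf =>
    aux_core G hT.1 p.length p.getVert (fun i j hij _ => aux_dist G x y p i j hij) hd f hf
  have hlen : p.length ≤ graphDiam G := by
    obtain ⟨q, hq, hql⟩ := hT.1.exists_path_of_dist x y
    have : q = p := congrArg Subtype.val (hT.2.path_unique ⟨q, hq⟩ ⟨p, hp⟩)
    rw [← this, hql]
    refine le_trans ?_ (Finset.le_sup (f := ecc G) (Finset.mem_univ y))
    exact Finset.le_sup (f := fun u => G.dist u y) (Finset.mem_univ x)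
  have hub : ∀ w ∈ {w | ∃ f, IsPackingBroadcast G f ∧ w = ∑ v, f v}, w ≤ graphDiam G := by
    rintro w ⟨f, hf, rfl⟩
    exact (hup f hf).trans hlen
  have hmem : graphDiam G ∈ {w | ∃ f, IsPackingBroadcast G f ∧ w = ∑ v, f v} := by
    obtain ⟨c, -, hc⟩ := Finset.exists_mem_eq_sup Finset.univ Finset.univ_nonempty (ecc G)
    refine ⟨fun v => if v = c then ecc G c else 0, ⟨?_, ?_⟩, ?_⟩
    · intro v
      dsimp only
      split_ifs with h
      · rw [h]
      · exact Nat.zero_le _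
    · rintro u v ⟨hv, -⟩ w ⟨hw, -⟩
      dsimp only at hv hw
      split_ifs at hv hw with h1 h2
      · rw [h1, h2]
      all_goals omega
    · simp only [Finset.sum_ite_eq', Finset.mem_univ, if_true]
      exact hc
  exact le_antisymm (csSup_le ⟨_, hmem⟩ hub) (le_csSup ⟨_, hub⟩ hmem)
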